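/- arXiv:1104.0232 — 2 statements merged into one kernel-verified Lean document; each statement's English description precedes it below -/
import Mathlib

section
/- Let n ≥ 3 and τ ≥ 4. Then the series S(t) = Σ_{k=0}^{∞} (1+k)^{1−2/n} M_k(t), where M_0(t) = e^{−(τ/2)|t|} and for k ≥ 1, M_k(t) = (1/k)·e^{−(k−τ)|t|} if τ < k, M_k(t) = 1/k if k ≤ τ < k+1, and M_k(t) = (1/k)·e^{−(τ−k−1)|t|} if τ ≥ k+1, satisfies S(t) ≤ C(1 + |t|^{−1+2/n}) for all t ≠ 0, with a constant C independent of τ and t. -/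
open Real Filter

/-- Partial sums of `∑ (1 + j)^{-a}` grow at most like `M^{1-a} / (1-a)`. -/
lemma sum_range_one_add_rpow_neg_le {a : ℝ} (ha0 : 0 ≤ a) (ha1 : a < 1) (M : ℕ) :
    ∑ j ∈ Finset.range M, (1 + (j : ℝ)) ^ (-a) ≤ (M : ℝ) ^ (1 - a) / (1 - a) := by
  have h1a : 0 < 1 - a := by linarith
  induction M with
  | zero => simp [Real.zero_rpow h1a.ne']
  | succ M ih =>
    rw [Finset.sum_range_succ]
    have hM : (0 : ℝ) < 1 + M := by positivity
    have hbern := rpow_one_add_le_one_add_mul_self (s := -1 / (1 + (M : ℝ)))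
      (by rw [le_div_iff₀ hM]; nlinarith [(Nat.cast_nonneg M : (0 : ℝ) ≤ M)])
      h1a.le (by linarith : 1 - a ≤ 1)
    have hsplit : (M : ℝ) ^ (1 - a)
        = (1 + (M : ℝ)) ^ (1 - a) * (1 + -1 / (1 + (M : ℝ))) ^ (1 - a) := by
      have h : 1 + -1 / (1 + (M : ℝ)) = M / (1 + M) := by field_simp; ring
      rw [h, ← Real.mul_rpow hM.le (by positivity), mul_div_cancel₀ _ hM.ne']
    have hpow : (1 + (M : ℝ)) ^ (1 - a) = (1 + M) * (1 + (M : ℝ)) ^ (-a) := by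
      rw [sub_eq_add_neg, Real.rpow_add hM, Real.rpow_one]
    have hstep : (M : ℝ) ^ (1 - a) ≤ (1 + (M : ℝ)) ^ (1 - a) - (1 - a) * (1 + (M : ℝ)) ^ (-a) := by
      calc (M : ℝ) ^ (1 - a)
          ≤ (1 + (M : ℝ)) ^ (1 - a) * (1 + (1 - a) * (-1 / (1 + (M : ℝ)))) := by
            rw [hsplit]; gcongr
        _ = _ := by rw [hpow]; field_simp; ring
    rw [le_div_iff₀ h1a] at ih ⊢
    push_cast
    rw [add_comm (M : ℝ) 1]
    nlinarith

lemma mul_sum_range_exp_neg_le_one {s : ℝ} (L : ℕ) :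
    s * ∑ i ∈ Finset.range L, Real.exp (-((i : ℝ) + 1) * s) ≤ 1 := by
  have h : ∀ i : ℕ, s * Real.exp (-((i : ℝ) + 1) * s)
      ≤ Real.exp (-(i : ℝ) * s) - Real.exp (-((i + 1 : ℕ) : ℝ) * s) := by
    intro i
    have h1 : Real.exp (-(i : ℝ) * s) = Real.exp s * Real.exp (-((i : ℝ) + 1) * s) := by
      rw [← Real.exp_add]; ring_nf
    push_cast
    rw [h1]
    nlinarith [Real.add_one_le_exp s, Real.exp_pos (-((i : ℝ) + 1) * s)]
  rw [Finset.mul_sum]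
  refine (Finset.sum_le_sum fun i _ => h i).trans ?_
  rw [Finset.sum_range_sub']
  simp [Real.exp_nonneg]

/-- The discrete analogue of `∫₀^∞ r^{-a} e^{-rs} dr = Γ(1-a) s^{a-1}`. -/
lemma sum_range_one_add_rpow_neg_mul_exp_le {a s : ℝ} (ha0 : 0 ≤ a) (ha1 : a < 1) (hs : 0 < s)
    (K : ℕ) :
    ∑ j ∈ Finset.range K, (1 + (j : ℝ)) ^ (-a) * Real.exp (-(j : ℝ) * s)
      ≤ (1 / (1 - a) + 1) * (1 + s ^ (-1 + a)) := by
  have h1a : 0 < 1 - a := by linarith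
  set M := ⌈1 / s⌉₊
  have hM1 : (1 : ℝ) ≤ M := by
    exact_mod_cast Nat.one_le_iff_ne_zero.2 (Nat.ceil_pos.2 (by positivity)).ne'
  have hMs : 1 / s ≤ M := Nat.le_ceil _
  have hinv : (1 / s) ^ (1 - a) = s ^ (-1 + a) := by
    rw [one_div, Real.inv_rpow hs.le, ← Real.rpow_neg hs.le]; ring_nf
  have hhead : ∑ j ∈ Finset.range M, (1 + (j : ℝ)) ^ (-a) * Real.exp (-(j : ℝ) * s)
      ≤ 1 / (1 - a) * (1 + s ^ (-1 + a)) := by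
    calc _ ≤ ∑ j ∈ Finset.range M, (1 + (j : ℝ)) ^ (-a) := by
          refine Finset.sum_le_sum fun j _ => mul_le_of_le_one_right (by positivity) ?_
          rw [Real.exp_le_one_iff, neg_mul, neg_nonpos]
          positivity
      _ ≤ (M : ℝ) ^ (1 - a) / (1 - a) := sum_range_one_add_rpow_neg_le ha0 ha1 M
      _ ≤ (1 + 1 / s) ^ (1 - a) / (1 - a) := by
          gcongr
          linarith [Nat.ceil_lt_add_one (by positivity : 0 ≤ 1 / s)]
      _ ≤ (1 ^ (1 - a) + (1 / s) ^ (1 - a)) / (1 - a) := by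
          gcongr
          exact Real.rpow_add_le_add_rpow zero_le_one (by positivity) h1a.le (by linarith)
      _ = _ := by rw [hinv, Real.one_rpow]; ring
  have htail : ∑ i ∈ Finset.range K,
      (1 + ((M + i : ℕ) : ℝ)) ^ (-a) * Real.exp (-((M + i : ℕ) : ℝ) * s) ≤ s ^ (-1 + a) := by
    calc _ ≤ ∑ i ∈ Finset.range K, s ^ a * Real.exp (-((i : ℝ) + 1) * s) := by
          refine Finset.sum_le_sum fun i _ => ?_
          have hi : (0 : ℝ) ≤ i := Nat.cast_nonneg i
          gcongr
          · have h : s ^ a = (1 / s) ^ (-a) := by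
              rw [one_div, Real.inv_rpow hs.le, Real.rpow_neg hs.le, inv_inv]
            rw [h]
            refine Real.rpow_le_rpow_of_nonpos (by positivity) ?_ (by linarith)
            push_cast
            linarith
          · push_cast
            linarith
      _ = s ^ (-1 + a) * (s * ∑ i ∈ Finset.range K, Real.exp (-((i : ℝ) + 1) * s)) := by
          have h : s ^ a = s ^ (-1 + a) * s := by
            rw [← Real.rpow_add_one hs.ne']; ring_nf
          rw [← Finset.mul_sum, h, mul_assoc]
      _ ≤ s ^ (-1 + a) :=
          mul_le_of_le_one_right (by positivity) (mul_sum_range_exp_neg_le_one K)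
  calc _ ≤ ∑ j ∈ Finset.range (M + K), (1 + (j : ℝ)) ^ (-a) * Real.exp (-(j : ℝ) * s) :=
        Finset.sum_le_sum_of_subset_of_nonneg (Finset.range_mono (by omega))
          fun _ _ _ => by positivity
    _ ≤ 1 / (1 - a) * (1 + s ^ (-1 + a)) + s ^ (-1 + a) := by
        rw [Finset.sum_range_add]
        exact add_le_add hhead htail
    _ ≤ _ := by linarith

/-- Pairing the decreasing weight `(1 + k)^{-a}` with the increasing weight `e^{-js}`, `j` being
the distance of `k` to the right end, costs no more than the two similarly ordered pairings. -/
lemma one_add_rpow_neg_mul_exp_le_add {a s : ℝ} (ha0 : 0 ≤ a) (hs : 0 ≤ s) (k j : ℕ) :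
    (1 + (k : ℝ)) ^ (-a) * Real.exp (-(j : ℝ) * s)
      ≤ (1 + (k : ℝ)) ^ (-a) * Real.exp (-(k : ℝ) * s)
        + (1 + (j : ℝ)) ^ (-a) * Real.exp (-(j : ℝ) * s) := by
  rcases le_total k j with h | h
  · have h' : (k : ℝ) ≤ j := by exact_mod_cast h
    refine le_add_of_le_of_nonneg ?_ (by positivity)
    gcongr
  · have h' : (j : ℝ) ≤ k := by exact_mod_cast h
    refine le_add_of_nonneg_of_le (by positivity) ?_
    gcongr ?_ * _
    exact Real.rpow_le_rpow_of_nonpos (by positivity) (by linarith) (by linarith)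

lemma one_add_succ_rpow_mul_inv_le {a : ℝ} (ha0 : 0 ≤ a) (k : ℕ) :
    (1 + ((k + 1 : ℕ) : ℝ)) ^ (1 - a) * (1 / ((k + 1 : ℕ) : ℝ)) ≤ 2 * (1 + (k : ℝ)) ^ (-a) := by
  have hk : (0 : ℝ) ≤ k := Nat.cast_nonneg k
  have hpos : (0 : ℝ) < 1 + ((k + 1 : ℕ) : ℝ) := by positivity
  have hmono : (1 + ((k + 1 : ℕ) : ℝ)) ^ (-a) ≤ (1 + (k : ℝ)) ^ (-a) :=
    Real.rpow_le_rpow_of_nonpos (by positivity) (by push_cast; linarith) (by linarith)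
  rw [sub_eq_add_neg, Real.rpow_add hpos, Real.rpow_one, mul_one_div,
    div_le_iff₀ (by positivity)]
  have hle : 1 + ((k + 1 : ℕ) : ℝ) ≤ 2 * ((k + 1 : ℕ) : ℝ) := by push_cast; linarith
  calc _ ≤ 2 * ((k + 1 : ℕ) : ℝ) * (1 + (k : ℝ)) ^ (-a) := by gcongr
    _ = _ := by ring

/-- The series bound (2.8): for `n ≥ 3` there is a constant `C` (independent of `τ ≥ 4`
and of `t ≠ 0`) such that
`Σ_{k≥0} (1+k)^{1−2/n} M_k(t) ≤ C (1 + |t|^{−1+2/n})`, where `M_0(t) = e^{−(τ/2)|t|}` and,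
for `k ≥ 1`, `M_k(t) = (1/k) e^{−(k−τ)|t|}` if `τ < k`, `M_k(t) = 1/k` if `k ≤ τ < k+1`,
and `M_k(t) = (1/k) e^{−(τ−k−1)|t|}` if `τ ≥ k+1`. -/
theorem stmt_3 (n : ℕ) (hn : 3 ≤ n) :
    ∃ C : ℝ, 0 < C ∧ ∀ τ t : ℝ, 4 ≤ τ → t ≠ 0 →
      (∑' k : ℕ, (1 + (k : ℝ)) ^ ((1 : ℝ) - 2 / (n : ℝ)) *
        (if k = 0 then Real.exp (-(τ / 2) * |t|)
         else if τ < (k : ℝ) then (1 / (k : ℝ)) * Real.exp (-((k : ℝ) - τ) * |t|)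
         else if τ < (k : ℝ) + 1 then 1 / (k : ℝ)
         else (1 / (k : ℝ)) * Real.exp (-(τ - (k : ℝ) - 1) * |t|)))
      ≤ C * (1 + |t| ^ (-1 + 2 / (n : ℝ))) := by
  have hn' : (3 : ℝ) ≤ n := by exact_mod_cast hn
  generalize hadef : 2 / (n : ℝ) = a
  have ha0 : 0 ≤ a := by rw [← hadef]; positivity
  have ha1 : a < 1 := by
    rw [← hadef, div_lt_one (by linarith)]
    linarith
  have h1a : 0 < 1 - a := by linarith
  set D := 1 / (1 - a) + 1
  have hD0 : 0 < D := by positivity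
  refine ⟨3 + 6 * D, by positivity, fun τ t hτ ht => ?_⟩
  have hs : 0 < |t| := abs_pos.2 ht
  generalize |t| = s at hs
  set b : ℕ → ℝ := fun j => (1 + (j : ℝ)) ^ (-a) * Real.exp (-(j : ℝ) * s) with hb
  have hB : ∀ K, ∑ j ∈ Finset.range K, b j ≤ D * (1 + s ^ (-1 + a)) :=
    sum_range_one_add_rpow_neg_mul_exp_le ha0 ha1 hs
  set f : ℕ → ℝ := fun k => (1 + (k : ℝ)) ^ (1 - a) *
        (if k = 0 then Real.exp (-(τ / 2) * s)
         else if τ < (k : ℝ) then (1 / (k : ℝ)) * Real.exp (-((k : ℝ) - τ) * s)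
         else if τ < (k : ℝ) + 1 then 1 / (k : ℝ)
         else (1 / (k : ℝ)) * Real.exp (-(τ - (k : ℝ) - 1) * s)) with hf
  have hf0 : ∀ k, 0 ≤ f k := fun k => by
    simp only [hf]
    split_ifs <;> positivity
  obtain ⟨m, hm⟩ : ∃ m, ⌊τ⌋₊ = m + 1 :=
    Nat.exists_eq_succ_of_ne_zero (Nat.floor_pos.2 (by linarith)).ne'
  have hmle : (m : ℝ) + 1 ≤ τ := by
    have h := Nat.floor_le (by linarith : 0 ≤ τ)
    rw [hm] at h
    exact_mod_cast h
  have hltm : τ < (m : ℝ) + 2 := by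
    have h := Nat.lt_floor_add_one τ
    rw [hm] at h
    push_cast at h
    linarith
  have hzero : f 0 ≤ 1 := by
    simp only [hf, if_true, Nat.cast_zero, add_zero, Real.one_rpow, one_mul]
    rw [Real.exp_le_one_iff, neg_mul, neg_nonpos]
    positivity
  have hmid : f (m + 1) ≤ 2 := by
    have h1 : ¬ τ < ((m + 1 : ℕ) : ℝ) := by push_cast; linarith
    have h2 : τ < ((m + 1 : ℕ) : ℝ) + 1 := by push_cast; linarith
    simp only [hf, Nat.succ_ne_zero, if_false, h1, h2, if_true]
    refine (one_add_succ_rpow_mul_inv_le ha0 m).trans ?_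
    have := Real.rpow_le_one_of_one_le_of_nonpos
      (by linarith [(Nat.cast_nonneg m : (0 : ℝ) ≤ m)] : (1 : ℝ) ≤ 1 + m)
      (by linarith : -a ≤ 0)
    linarith
  have hlow : ∀ k ∈ Finset.range m, f (k + 1) ≤ 2 * (b k + b (m - 1 - k)) := by
    intro k hk
    have hkm : k + 1 ≤ m := Finset.mem_range.1 hk
    have hcast : ((m - 1 - k : ℕ) : ℝ) = m - 1 - k := by
      rw [Nat.sub_sub, Nat.cast_sub (by omega)]
      push_cast
      ring
    have hkm' : (k : ℝ) + 1 ≤ m := by exact_mod_cast hkm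
    have h1 : ¬ τ < ((k + 1 : ℕ) : ℝ) := by push_cast; linarith
    have h2 : ¬ τ < ((k + 1 : ℕ) : ℝ) + 1 := by push_cast; linarith
    simp only [hf, Nat.succ_ne_zero, if_false, h1, h2]
    rw [← mul_assoc]
    calc _ ≤ 2 * (1 + (k : ℝ)) ^ (-a) * Real.exp (-((m - 1 - k : ℕ) : ℝ) * s) := by
          gcongr ?_ * Real.exp (?_ * s)
          · exact one_add_succ_rpow_mul_inv_le ha0 k
          · rw [hcast]
            push_cast
            linarith
      _ ≤ _ := by
          rw [mul_assoc]
          gcongr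
          exact one_add_rpow_neg_mul_exp_le_add ha0 hs.le k (m - 1 - k)
  have hhigh : ∀ i, f (m + 2 + i) ≤ 2 * b i := by
    intro i
    have hi : (0 : ℝ) ≤ i := Nat.cast_nonneg i
    have h1 : τ < ((m + 1 + i + 1 : ℕ) : ℝ) := by push_cast; linarith
    rw [show m + 2 + i = m + 1 + i + 1 by omega]
    simp only [hf, Nat.succ_ne_zero, if_false, h1, if_true, hb]
    rw [← mul_assoc, ← mul_assoc]
    gcongr ?_ * Real.exp (?_ * s)
    · refine (one_add_succ_rpow_mul_inv_le ha0 (m + 1 + i)).trans ?_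
      gcongr 2 * ?_
      refine Real.rpow_le_rpow_of_nonpos (by positivity) ?_ (by linarith)
      push_cast
      linarith [(Nat.cast_nonneg m : (0 : ℝ) ≤ m)]
    · push_cast
      linarith
  refine Real.tsum_le_of_sum_range_le hf0 fun K => ?_
  have hlow_sum : ∑ k ∈ Finset.range m, f (k + 1) ≤ 4 * (D * (1 + s ^ (-1 + a))) := by
    refine (Finset.sum_le_sum hlow).trans ?_
    rw [← Finset.mul_sum, Finset.sum_add_distrib, Finset.sum_range_reflect]
    linarith [hB m]
  have hhigh_sum : ∑ i ∈ Finset.range K, f (m + 2 + i) ≤ 2 * (D * (1 + s ^ (-1 + a))) := by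
    refine (Finset.sum_le_sum fun i _ => hhigh i).trans ?_
    rw [← Finset.mul_sum]
    linarith [hB K]
  have hspos : 0 ≤ s ^ (-1 + a) := by positivity
  calc ∑ k ∈ Finset.range K, f k ≤ ∑ k ∈ Finset.range (m + 2 + K), f k :=
        Finset.sum_le_sum_of_subset_of_nonneg (Finset.range_mono (by omega)) fun k _ _ => hf0 k
    _ = ∑ k ∈ Finset.range m, f (k + 1) + f 0 + f (m + 1)
        + ∑ i ∈ Finset.range K, f (m + 2 + i) := by
        rw [Finset.sum_range_add, Finset.sum_range_succ, Finset.sum_range_succ']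
    _ ≤ (3 + 6 * D) * (1 + s ^ (-1 + a)) := by linarith
end

section
/- Let K : ℝ^{n−1} × ℝ^{n−1} → ℂ be smooth away from {y = 0}, compactly supported, satisfying |∂_x^α ∂_y^β K(x,y)| ≤ C_{α,β} |y|^{−(n−3)−|β|} for y ≠ 0 (i.e. homogeneous-type bounds of degree −(n−3) = 2−(n−1)). Then the symbol p(x,ξ) = ∫ K(x,y) e^{−iy·ξ} dy satisfies |p(x,ξ)| ≤ C(1+|ξ|)^{−1} uniformly in x. -/
open Real Complex MeasureTheory Matrix

/-- The locally integrable singularity `‖y‖⁻ᵐ` in dimension `m + 1`, truncated to a ball. -/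
lemma integrable_indicator_inv_norm_pow (m : ℕ) (R : ℝ) :
    Integrable (fun y : Fin (m + 1) → ℝ =>
      (Set.Iic R).indicator (fun r : ℝ => (r ^ m)⁻¹) ‖y‖) := by
  rw [integrable_fun_norm_addHaar (μ := (volume : Measure (Fin (m + 1) → ℝ)))]
  have h1 : IntegrableOn (fun _ : ℝ => (1 : ℝ)) (Set.Ioc 0 R) := by simp
  have h2 : IntegrableOn ((Set.Iic R).indicator fun _ : ℝ => (1 : ℝ)) (Set.Ioi 0) := by
    rw [IntegrableOn, integrable_indicator_iff measurableSet_Iic, IntegrableOn,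
      Measure.restrict_restrict measurableSet_Iic, Set.inter_comm, Set.Ioi_inter_Iic]
    exact h1
  refine h2.congr_fun (fun r hr => ?_) measurableSet_Ioi
  have hr' : (r : ℝ) ^ m ≠ 0 := pow_ne_zero _ (ne_of_gt hr)
  by_cases h : r ∈ Set.Iic R
  · simp [Set.indicator_of_mem h, hr']
  · simp [Set.indicator_of_notMem h]

/-- In dimension at least two, a partial derivative integrates to zero even if the function
fails to be differentiable at the origin. -/
lemma integral_fderiv_single_eq_zero {m : ℕ} (hm : 1 ≤ m) {F : (Fin (m + 1) → ℝ) → ℂ}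
    (hF : ∀ y, y ≠ 0 → DifferentiableAt ℝ F y) (hFi : Integrable F) (i : Fin (m + 1))
    (hF' : Integrable fun y => fderiv ℝ F y (Pi.single i 1)) :
    ∫ y, fderiv ℝ F y (Pi.single i 1) = 0 := by
  have : Nonempty (Fin m) := ⟨⟨0, hm⟩⟩
  have hmp := (volume_preserving_piFinSuccAbove (fun _ : Fin (m + 1) => ℝ) i).symm
  have hemb := (MeasurableEquiv.piFinSuccAbove (fun _ : Fin (m + 1) => ℝ) i).symm.measurableEmbedding
  have hFi₂ := (hmp.integrable_comp_emb hemb).2 hFi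
  have hF'₂ := (hmp.integrable_comp_emb hemb).2 hF'
  rw [← hmp.integral_comp hemb]
  rw [Measure.volume_eq_prod] at hFi₂ hF'₂ ⊢
  refine (integral_prod_symm _ hF'₂).trans (integral_eq_zero_of_ae ?_)
  filter_upwards [hFi₂.prod_left_ae, hF'₂.prod_left_ae,
    (Measure.ae_ne (volume : Measure (Fin m → ℝ)) 0)] with w h1 h2 hw
  refine integral_eq_zero_of_hasDerivAt_of_integrable (fun t => ?_) h2 h1
  have hne : (i.insertNth t w : Fin (m + 1) → ℝ) ≠ 0 := fun h => hw <| by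
    ext j
    simpa using congrFun h (i.succAbove j)
  have hd : HasDerivAt (fun s : ℝ => (i.insertNth s w : Fin (m + 1) → ℝ)) (Pi.single i 1) t := by
    refine (hasDerivAt_update (i.insertNth t w : Fin (m + 1) → ℝ) i t).congr_of_eventuallyEq ?_
    exact .of_forall fun s =>
      (Fin.update_insertNth (α := fun _ : Fin (m + 1) => ℝ) i t s w).symm
  exact (hF _ hne).hasFDerivAt.comp_hasDerivAt t hd

lemma norm_exp_neg_I_mul_ofReal (s : ℝ) : ‖Complex.exp (-Complex.I * (s : ℂ))‖ = 1 := by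
  rw [show -Complex.I * (s : ℂ) = ((-s : ℝ) : ℂ) * Complex.I by push_cast; ring,
    Complex.norm_exp_ofReal_mul_I]

/-- One integration by parts in the Fourier integral, with a possible singularity at the origin. -/
lemma abs_mul_norm_integral_mul_exp_le {m : ℕ} (hm : 1 ≤ m) {f : (Fin (m + 1) → ℝ) → ℂ}
    (hf : ∀ y, y ≠ 0 → DifferentiableAt ℝ f y) (hfi : Integrable f)
    (hf' : Integrable (fderiv ℝ f)) (ξ : Fin (m + 1) → ℝ) (i : Fin (m + 1)) :
    |ξ i| * ‖∫ y, f y * Complex.exp (-Complex.I * ((y ⬝ᵥ ξ : ℝ) : ℂ))‖ ≤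
      ∫ y, ‖fderiv ℝ f y‖ := by
  set e : (Fin (m + 1) → ℝ) → ℂ := fun y => Complex.exp (-Complex.I * ((y ⬝ᵥ ξ : ℝ) : ℂ)) with he
  have hnorm : ∀ y, ‖e y‖ = 1 := fun y => norm_exp_neg_I_mul_ofReal _
  have hdot : Differentiable ℝ fun y : Fin (m + 1) → ℝ => ((y ⬝ᵥ ξ : ℝ) : ℂ) := by
    have h : Differentiable ℝ fun y : Fin (m + 1) → ℝ => y ⬝ᵥ ξ := by
      unfold dotProduct
      fun_prop
    exact Complex.ofRealCLM.differentiable.comp h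
  have hed : Differentiable ℝ e := (hdot.const_mul _).cexp
  have hem : AEStronglyMeasurable e := hed.continuous.aestronglyMeasurable
  have hbdd : ∀ᵐ y, ‖e y‖ ≤ 1 := .of_forall fun y => (hnorm y).le
  have hde : ∀ y, fderiv ℝ e y (Pi.single i 1) = -Complex.I * ξ i * e y := fun y => by
    have h1 : HasDerivAt (fun t : ℝ => y + t • (Pi.single i 1 : Fin (m + 1) → ℝ))
        (Pi.single i 1) 0 := by
      simpa using ((hasDerivAt_id (0 : ℝ)).smul_const
        (Pi.single i 1 : Fin (m + 1) → ℝ)).const_add y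
    have h2 : HasDerivAt (fun t : ℝ => e (y + t • (Pi.single i 1 : Fin (m + 1) → ℝ)))
        (fderiv ℝ e y (Pi.single i 1)) 0 := by
      have := (hed (y + (0 : ℝ) • (Pi.single i 1 : Fin (m + 1) → ℝ))).hasFDerivAt.comp_hasDerivAt
        (0 : ℝ) h1
      simpa [Function.comp_def] using this
    have h3 : HasDerivAt (fun t : ℝ => e (y + t • (Pi.single i 1 : Fin (m + 1) → ℝ)))
        (-Complex.I * ξ i * e y) 0 := by
      have h4 : HasDerivAt (fun t : ℝ => -Complex.I * ((y ⬝ᵥ ξ + t * ξ i : ℝ) : ℂ))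
          (-Complex.I * ((ξ i : ℝ) : ℂ)) 0 := by
        refine HasDerivAt.const_mul _ (HasDerivAt.ofReal_comp ?_)
        simpa using ((hasDerivAt_id (0 : ℝ)).mul_const (ξ i)).const_add (y ⬝ᵥ ξ)
      have h5 := h4.cexp
      simp only [he, add_dotProduct, smul_dotProduct, single_dotProduct, one_mul, smul_eq_mul]
      convert h5 using 1
      simp [mul_comm]
    exact h2.unique h3
  have hfe : Integrable fun y => f y * e y := hfi.mul_bdd hem hbdd
  have hdi : Integrable fun y => fderiv ℝ f y (Pi.single i 1) :=
    hf'.apply_continuousLinearMap _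
  have hdie : Integrable fun y => fderiv ℝ f y (Pi.single i 1) * e y := hdi.mul_bdd hem hbdd
  have hprod : ∀ y, y ≠ 0 → fderiv ℝ (fun y => f y * e y) y (Pi.single i 1) =
      fderiv ℝ f y (Pi.single i 1) * e y - Complex.I * ξ i * (f y * e y) := fun y hy => by
    rw [fderiv_fun_mul (hf y hy) (hed y)]
    simp only [_root_.add_apply, _root_.smul_apply, smul_eq_mul, hde]
    ring
  have hae : (fun y => fderiv ℝ (fun y => f y * e y) y (Pi.single i 1)) =ᵐ[volume]
      fun y => fderiv ℝ f y (Pi.single i 1) * e y - Complex.I * ξ i * (f y * e y) := by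
    filter_upwards [Measure.ae_ne (volume : Measure (Fin (m + 1) → ℝ)) 0] with y hy
    exact hprod y hy
  have hzero := integral_fderiv_single_eq_zero hm (F := fun y => f y * e y)
    (fun y hy => (hf y hy).mul (hed y)) hfe i
    ((hdie.sub (hfe.const_mul _)).congr hae.symm)
  rw [integral_congr_ae hae, integral_sub hdie (hfe.const_mul _), integral_const_mul,
    sub_eq_zero] at hzero
  calc |ξ i| * ‖∫ y, f y * e y‖ = ‖Complex.I * ξ i * ∫ y, f y * e y‖ := by simp
    _ = ‖∫ y, fderiv ℝ f y (Pi.single i 1) * e y‖ := by rw [hzero]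
    _ ≤ ∫ y, ‖fderiv ℝ f y‖ := by
      refine norm_integral_le_of_norm_le hf'.norm (.of_forall fun y => ?_)
      rw [norm_mul, hnorm, mul_one]
      refine (ContinuousLinearMap.le_opNorm _ _).trans ?_
      simp [Pi.norm_single]

/-- Dyadic symbol estimate: if `K(x,y)` is compactly supported, smooth away from `y = 0`,
with homogeneous-type bounds `|∂_y^β K(x,y)| ≤ C_β |y|^{−(n−3)−|β|}`, then the symbol
`p(x,ξ) = ∫ K(x,y) e^{−iy·ξ} dy` satisfies `|p(x,ξ)| ≤ C (1+|ξ|)^{−1}` uniformly in `x`. -/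
theorem stmt_18 (n : ℕ) (hn : 3 ≤ n)
    (K : ((Fin (n - 1) → ℝ) × (Fin (n - 1) → ℝ)) → ℂ)
    (hKsupp : HasCompactSupport K)
    (hKsmooth : ContDiffOn ℝ (⊤ : ℕ∞) K {p : (Fin (n - 1) → ℝ) × (Fin (n - 1) → ℝ) | p.2 ≠ 0})
    (hKbound : ∀ k : ℕ, ∃ C : ℝ, ∀ (x y : Fin (n - 1) → ℝ), y ≠ 0 →
      ‖iteratedFDeriv ℝ k (fun z => K (x, z)) y‖ ≤ C * ‖y‖ ^ (-((n : ℝ) - 3) - k)) :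
    ∃ C : ℝ, 0 < C ∧ ∀ (x ξ : Fin (n - 1) → ℝ),
      ‖∫ y : Fin (n - 1) → ℝ, K (x, y) * Complex.exp (-Complex.I * ((y ⬝ᵥ ξ : ℝ) : ℂ))‖ ≤
        C * (1 + ‖ξ‖)⁻¹ := by
  obtain ⟨m, rfl⟩ : ∃ m, n = m + 2 := ⟨n - 2, by omega⟩
  have hm : 1 ≤ m := by omega
  change ((Fin (m + 1) → ℝ) × (Fin (m + 1) → ℝ)) → ℂ at K
  obtain ⟨C₀, hC₀⟩ := hKbound 0
  obtain ⟨C₁, hC₁⟩ := hKbound 1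
  obtain ⟨R, hR0, hR⟩ : ∃ R : ℝ, 0 < R ∧ ∀ x y : Fin (m + 1) → ℝ, R < ‖y‖ → K (x, y) = 0 := by
    obtain ⟨R, hR⟩ := hKsupp.isCompact.isBounded.exists_norm_le
    refine ⟨max R 1, by positivity, fun x y hy => ?_⟩
    by_contra hne
    have := hR _ (subset_tsupport K hne)
    exact absurd ((norm_snd_le (x, y)).trans this)
      (not_le.2 ((le_max_left _ _).trans_lt hy))
  have hdR : ∀ x y : Fin (m + 1) → ℝ, R < ‖y‖ → fderiv ℝ (fun z => K (x, z)) y = 0 :=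
    fun x y hy => by
      have : (fun z => K (x, z)) =ᶠ[nhds y] fun _ => 0 := by
        filter_upwards [(isOpen_lt continuous_const continuous_norm).mem_nhds hy] with z hz
        exact hR x z hz
      rw [this.fderiv_eq]
      simp
  set g : (Fin (m + 1) → ℝ) → ℝ := fun y =>
    (Set.Iic R).indicator (fun r : ℝ => (r ^ m)⁻¹) ‖y‖ with hg
  have hgi : Integrable g := integrable_indicator_inv_norm_pow m R
  have hg0 : ∀ y, 0 ≤ g y := fun y =>
    Set.indicator_apply_nonneg fun _ => by positivity
  have hbound₀ : ∀ x y : Fin (m + 1) → ℝ, y ≠ 0 → ‖K (x, y)‖ ≤ |C₀| * R * g y := fun x y hy => by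
    by_cases h : ‖y‖ ≤ R
    · have hpos : 0 < ‖y‖ := norm_pos_iff.2 hy
      have h1 := hC₀ x y hy
      rw [norm_iteratedFDeriv_zero,
        show -(((m + 2 : ℕ) : ℝ) - 3) - ((0 : ℕ) : ℝ) = 1 + -(m : ℝ) by push_cast; ring,
        Real.rpow_add hpos, Real.rpow_one, Real.rpow_neg hpos.le, Real.rpow_natCast] at h1
      simp only [hg, Set.indicator_of_mem (Set.mem_Iic.2 h)]
      calc _ ≤ _ := h1
        _ ≤ |C₀| * (R * (‖y‖ ^ m)⁻¹) := by gcongr; exact le_abs_self _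
        _ = _ := by ring
    · rw [hR x y (not_le.1 h), norm_zero]
      have := hg0 y
      positivity
  have hbound₁ : ∀ x y : Fin (m + 1) → ℝ, y ≠ 0 →
      ‖fderiv ℝ (fun z => K (x, z)) y‖ ≤ |C₁| * g y := fun x y hy => by
    by_cases h : ‖y‖ ≤ R
    · have hpos : 0 < ‖y‖ := norm_pos_iff.2 hy
      have h1 := hC₁ x y hy
      rw [norm_iteratedFDeriv_one,
        show -(((m + 2 : ℕ) : ℝ) - 3) - ((1 : ℕ) : ℝ) = -(m : ℝ) by push_cast; ring,
        Real.rpow_neg hpos.le, Real.rpow_natCast] at h1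
      simp only [hg, Set.indicator_of_mem (Set.mem_Iic.2 h)]
      refine h1.trans ?_
      gcongr
      exact le_abs_self _
    · rw [hdR x y (not_le.1 h), norm_zero]
      have := hg0 y
      positivity
  have hopen : IsOpen {p : (Fin (m + 1) → ℝ) × (Fin (m + 1) → ℝ) | p.2 ≠ 0} :=
    isOpen_ne_fun continuous_snd continuous_const
  have hdiff : ∀ x y : Fin (m + 1) → ℝ, y ≠ 0 → DifferentiableAt ℝ (fun z => K (x, z)) y :=
    fun x y hy => by
      have h1 : DifferentiableAt ℝ K (x, y) :=
        (hKsmooth.contDiffAt (hopen.mem_nhds hy)).differentiableAt (by simp)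
      exact h1.comp y ((differentiableAt_const x).prodMk differentiableAt_id)
  have hne := Measure.ae_ne (volume : Measure (Fin (m + 1) → ℝ)) 0
  have hae₀ : ∀ x, ∀ᵐ y, ‖K (x, y)‖ ≤ |C₀| * R * g y := fun x => hne.mono (hbound₀ x)
  have hae₁ : ∀ x, ∀ᵐ y, ‖fderiv ℝ (fun z => K (x, z)) y‖ ≤ |C₁| * g y :=
    fun x => hne.mono (hbound₁ x)
  have hint₀ : ∀ x, Integrable fun y => K (x, y) := fun x => by
    refine (hgi.const_mul (|C₀| * R)).mono' ?_ (hae₀ x)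
    rw [← restrict_compl_singleton (μ := volume) (0 : Fin (m + 1) → ℝ)]
    refine ContinuousOn.aestronglyMeasurable (fun y hy => ?_) (measurableSet_singleton _).compl
    exact (hdiff x y hy).continuousAt.continuousWithinAt
  have hint₁ : ∀ x, Integrable (fderiv ℝ fun y => K (x, y)) := fun x =>
    (hgi.const_mul |C₁|).mono' (measurable_fderiv ℝ _).aestronglyMeasurable (hae₁ x)
  have hG : 0 ≤ ∫ y, g y := integral_nonneg hg0
  refine ⟨(|C₀| * R + |C₁|) * (∫ y, g y) + 1, by positivity,
    fun (x ξ : Fin (m + 1) → ℝ) => ?_⟩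
  change ‖∫ y : Fin (m + 1) → ℝ, _‖ ≤ _ * (1 + ‖ξ‖)⁻¹
  rw [← div_eq_mul_inv, le_div_iff₀ (by positivity)]
  have h₀ : ‖∫ y, K (x, y) * Complex.exp (-Complex.I * ((y ⬝ᵥ ξ : ℝ) : ℂ))‖ ≤
      |C₀| * R * ∫ y, g y := by
    rw [← integral_const_mul]
    refine norm_integral_le_of_norm_le (hgi.const_mul _) ((hae₀ x).mono fun y hy => ?_)
    rwa [norm_mul, norm_exp_neg_I_mul_ofReal, mul_one]
  have h₁ : ‖ξ‖ * ‖∫ y, K (x, y) * Complex.exp (-Complex.I * ((y ⬝ᵥ ξ : ℝ) : ℂ))‖ ≤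
      |C₁| * ∫ y, g y := by
    obtain ⟨i, hi⟩ : ∃ i, ‖ξ‖ = |ξ i| := by
      obtain ⟨i, -, hi⟩ := Finset.exists_max_image Finset.univ (fun i => |ξ i|)
        Finset.univ_nonempty
      exact ⟨i, le_antisymm ((pi_norm_le_iff_of_nonneg (abs_nonneg _)).2 fun j =>
        hi j (Finset.mem_univ j)) (norm_le_pi_norm ξ i)⟩
    rw [hi, ← integral_const_mul]
    exact (abs_mul_norm_integral_mul_exp_le hm (hdiff x) (hint₀ x) (hint₁ x) ξ i).trans
      (integral_mono_ae (hint₁ x).norm (hgi.const_mul _) (hae₁ x))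
  linarith
end
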